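/- arXiv:1405.4748 — 8 statements merged into one kernel-verified Lean document; each statement's English description precedes it below -/
import Mathlib

section
/- For all integers A ≥ 1 and B ≥ 1, the alternating sum ∑_{k=0}^{B} k · (-1)^{k+1} · C(A+B, A+k) equals C(A+B-2, B-1). -/
/-- Partial sums of `∑ (j + 1) (-1)^j C(n + 2, a + j + 2)` in closed form. -/
theorem sum_range_succ_mul_neg_one_pow_mul_choose (n a m : ℕ) :
    ∑ j ∈ Finset.range m, ((j : ℤ) + 1) * (-1) ^ j * ((n + 2).choose (a + j + 2) : ℤ) =
      n.choose a - (-1) ^ m * ((m + 1) * n.choose (a + m) + m * n.choose (a + m + 1)) := by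
  induction m with
  | zero => simp
  | succ m ih =>
    rw [Finset.sum_range_succ, ih, Nat.choose_succ_succ' (n + 1), Nat.choose_succ_succ' n,
      Nat.choose_succ_succ' n]
    simp only [← add_assoc]
    push_cast
    ring

/-- For all integers `A ≥ 1` and `B ≥ 1`, the alternating sum
`∑_{k=0}^{B} k · (-1)^{k+1} · C(A+B, A+k)` equals `C(A+B-2, B-1)`. -/
theorem alternating_weighted_sum_choose (A B : ℕ) (hA : 1 ≤ A) (hB : 1 ≤ B) :
    ∑ k ∈ Finset.range (B + 1),
        (k : ℤ) * (-1 : ℤ) ^ (k + 1) * (Nat.choose (A + B) (A + k) : ℤ) =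
      (Nat.choose (A + B - 2) (B - 1) : ℤ) := by
  obtain ⟨a, rfl⟩ := Nat.exists_eq_add_of_le' hA
  obtain ⟨b, rfl⟩ := Nat.exists_eq_add_of_le' hB
  have h := sum_range_succ_mul_neg_one_pow_mul_choose (a + b) a (b + 1)
  rw [Nat.choose_eq_zero_of_lt (show a + b < a + (b + 1) by omega),
    Nat.choose_eq_zero_of_lt (show a + b < a + (b + 1) + 1 by omega)] at h
  rw [Finset.sum_range_succ', show a + 1 + (b + 1) - 2 = a + b by omega, Nat.add_sub_cancel,
    ← Nat.choose_symm_add]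
  simp only [Nat.cast_zero, mul_zero, add_zero, sub_zero, zero_mul] at h ⊢
  rw [← h]
  refine Finset.sum_congr rfl fun j _ => ?_
  rw [show a + 1 + (b + 1) = a + b + 2 by omega, show a + 1 + (j + 1) = a + j + 2 by omega]
  push_cast
  ring
end

section
/- For all integers n ≥ 1, q ≥ 0 and l with 0 ≤ l ≤ q, the alternating sum ∑_{k=0}^{q+1} (-1)^{l+k+q+1} · C(n+q+1, n+k) · C(k, q+1-l) equals C(n+l-1, l). -/
/-- Orthogonality of the signed and unsigned binomial matrices, off the diagonal. -/
theorem alternating_sum_choose_mul_choose_eq_zero (l j : ℕ) :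
    ∑ i ∈ Finset.range (l + 2),
      (-1 : ℤ) ^ i * (Nat.choose (j + (l + 1)) (j + i) : ℤ) * (Nat.choose (j + i) j : ℤ) = 0 := by
  have h := Int.alternating_sum_range_choose_of_ne (n := l + 1) (by omega)
  rw [← mul_zero (Nat.choose (j + (l + 1)) j : ℤ), ← h, Finset.mul_sum]
  refine Finset.sum_congr rfl fun i _ => ?_
  have hc := Nat.choose_mul (n := j + (l + 1)) (k := j + i) (s := j) (by omega)
  rw [Nat.add_sub_cancel_left, Nat.add_sub_cancel_left] at hc
  have hz : (Nat.choose (j + (l + 1)) (j + i) : ℤ) * (Nat.choose (j + i) j : ℤ) =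
      (Nat.choose (j + (l + 1)) j : ℤ) * (Nat.choose (l + 1) i : ℤ) := by exact_mod_cast hc
  linear_combination (-1 : ℤ) ^ i * hz

/-- Pascal's rule in the first binomial coefficient of the shifted alternating sum. -/
theorem alternating_sum_choose_mul_choose_succ (n l j : ℕ) :
    ∑ i ∈ Finset.range (l + 2), (-1 : ℤ) ^ i *
        (Nat.choose (n + 1 + j + (l + 1)) (n + 1 + j + i) : ℤ) * (Nat.choose (j + i) j : ℤ) =
      ∑ i ∈ Finset.range (l + 1), (-1 : ℤ) ^ i *
        (Nat.choose (n + 1 + j + l) (n + 1 + j + i) : ℤ) * (Nat.choose (j + i) j : ℤ) +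
      ∑ i ∈ Finset.range (l + 2), (-1 : ℤ) ^ i *
        (Nat.choose (n + j + (l + 1)) (n + j + i) : ℤ) * (Nat.choose (j + i) j : ℤ) := by
  have hlast : ∑ i ∈ Finset.range (l + 1), (-1 : ℤ) ^ i *
        (Nat.choose (n + 1 + j + l) (n + 1 + j + i) : ℤ) * (Nat.choose (j + i) j : ℤ) =
      ∑ i ∈ Finset.range (l + 2), (-1 : ℤ) ^ i *
        (Nat.choose (n + 1 + j + l) (n + 1 + j + i) : ℤ) * (Nat.choose (j + i) j : ℤ) := by
    rw [Finset.sum_range_succ _ (l + 1), Nat.choose_eq_zero_of_lt (by omega)]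
    simp
  rw [hlast, ← Finset.sum_add_distrib]
  refine Finset.sum_congr rfl fun i _ => ?_
  rw [show n + 1 + j + (l + 1) = (n + j + (l + 1)) + 1 by omega,
    show n + 1 + j + i = (n + j + i) + 1 by omega, Nat.choose_succ_succ',
    show n + 1 + j + l = n + j + (l + 1) by omega]
  push_cast
  ring

theorem alternating_sum_choose_mul_choose (n l j : ℕ) :
    ∑ i ∈ Finset.range (l + 1), (-1 : ℤ) ^ i *
        (Nat.choose (n + 1 + j + l) (n + 1 + j + i) : ℤ) * (Nat.choose (j + i) j : ℤ) =
      (Nat.choose (n + l) l : ℤ) := by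
  induction l generalizing n with
  | zero => simp
  | succ l ihl =>
    induction n with
    | zero =>
      rw [alternating_sum_choose_mul_choose_succ, ihl]
      simpa using alternating_sum_choose_mul_choose_eq_zero l j
    | succ n ihn =>
      rw [alternating_sum_choose_mul_choose_succ, ihl, ihn,
        show n + 1 + (l + 1) = (n + 1 + l) + 1 by omega, Nat.choose_succ_succ',
        show n + 1 + l = n + (l + 1) by omega]
      push_cast
      ring

/-- For all integers `n ≥ 1`, `q ≥ 0` and `0 ≤ l ≤ q`, the alternating sum
`∑_{k=0}^{q+1} (-1)^{l+k+q+1} · C(n+q+1, n+k) · C(k, q+1-l)` equals `C(n+l-1, l)`. -/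
theorem alternating_double_choose_sum (n q l : ℕ) (hn : 1 ≤ n) (hl : l ≤ q) :
    ∑ k ∈ Finset.range (q + 2),
        (-1 : ℤ) ^ (l + k + q + 1) * (Nat.choose (n + q + 1) (n + k) : ℤ) *
          (Nat.choose k (q + 1 - l) : ℤ) =
      (Nat.choose (n + l - 1) l : ℤ) := by
  obtain ⟨n, rfl⟩ := Nat.exists_eq_add_of_le' hn
  obtain ⟨d, rfl⟩ := Nat.exists_eq_add_of_le hl
  rw [show l + d + 2 = (d + 1) + (l + 1) by omega, show l + d + 1 - l = d + 1 by omega,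
    show n + 1 + l - 1 = n + l by omega, Finset.sum_range_add, Finset.sum_eq_zero, zero_add,
    ← alternating_sum_choose_mul_choose n l (d + 1)]
  · refine Finset.sum_congr rfl fun i _ => ?_
    have hs : (-1 : ℤ) ^ (l + (d + 1 + i) + (l + d) + 1) = (-1) ^ i := by
      rw [show l + (d + 1 + i) + (l + d) + 1 = 2 * (l + d + 1) + i by omega, pow_add, pow_mul]
      simp
    rw [hs, show n + 1 + (l + d) + 1 = n + 1 + (d + 1) + l by omega, add_assoc (n + 1) (d + 1) i]
  · intro k hk
    rw [Nat.choose_eq_zero_of_lt (Finset.mem_range.mp hk), Nat.cast_zero, mul_zero]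
end

section
/- For all integers n ≥ 1, q ≥ 1 and every real x with 0 ≤ x ≤ 1, the incomplete Beta integral satisfies ∫_0^{1-x} u^{n-1}(1-u)^{q-1} du = (1-x)^n · ((n-1)!·(q-1)!/(n+q-1)!) · ∑_{l=0}^{q-1} C(n+l-1, l) · x^l. -/
open scoped Nat

theorem hasDerivAt_incomplete_beta (m p : ℕ) (t : ℝ) :
    HasDerivAt (fun t : ℝ => t ^ (m + 1) * ((m ! * p ! : ℝ) / ((m + p + 1)! : ℝ)) *
      ∑ l ∈ Finset.range (p + 1), (Nat.choose (m + l) l : ℝ) * (1 - t) ^ l)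
      (t ^ m * (1 - t) ^ p) t := by
  induction p with
  | zero =>
    have hm : (m + 1 : ℝ) ≠ 0 := by positivity
    refine (((hasDerivAt_pow (m + 1) t).mul_const ((m + 1 : ℝ)⁻¹)).congr_of_eventuallyEq
      (.of_forall fun s => ?_)).congr_deriv ?_
    · have : (m ! : ℝ) ≠ 0 := by positivity
      simp only [add_zero, zero_add, Finset.sum_range_one, Nat.choose_zero_right,
        Nat.factorial_succ, Nat.factorial_zero, pow_zero]
      push_cast
      field_simp
    · push_cast
      simp only [pow_zero]
      field_simp
  | succ p ih =>
    have hN : (m + p + 2 : ℝ) ≠ 0 := by positivity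
    have h1 : HasDerivAt (fun t : ℝ => (1 - t) ^ (p + 1)) (-((p + 1) * (1 - t) ^ p)) t :=
      (((hasDerivAt_id' t).const_sub 1).fun_pow (p + 1)).congr_deriv (by simp)
    have h := (ih.const_mul ((p + 1 : ℝ) / (m + p + 2))).fun_add
      (((hasDerivAt_pow (m + 1) t).fun_mul h1).mul_const ((m + p + 2 : ℝ)⁻¹))
    refine (h.congr_of_eventuallyEq (.of_forall fun s => ?_)).congr_deriv ?_
    · have hc : (Nat.choose (m + (p + 1)) (p + 1) : ℝ) = (m + p + 1)! / (m ! * (p + 1)!) := by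
        rw [Nat.cast_choose ℝ (Nat.le_add_left _ _), Nat.add_sub_cancel, mul_comm (m ! : ℝ),
          add_assoc]
      have hf : ((m + (p + 1) + 1)! : ℝ) = (m + p + 2) * (m + p + 1)! := by
        rw [← add_assoc, Nat.factorial_succ (m + p + 1)]
        push_cast
        ring
      have hp : ((p + 1)! : ℝ) = (p + 1) * p ! := by
        rw [Nat.factorial_succ]
        push_cast
        ring
      have : (m ! : ℝ) ≠ 0 := by positivity
      have : (p ! : ℝ) ≠ 0 := by positivity
      have : ((m + p + 1)! : ℝ) ≠ 0 := by positivity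
      have : (p + 1 : ℝ) ≠ 0 := by positivity
      rw [Finset.sum_range_succ, hc, hf, hp]
      field_simp
    · push_cast
      field_simp
      ring

/-- For all integers `n ≥ 1`, `q ≥ 1` and every real `x` with `0 ≤ x ≤ 1`, the
incomplete Beta integral satisfies
`∫_0^{1-x} u^{n-1}(1-u)^{q-1} du
  = (1-x)^n · ((n-1)!·(q-1)!/(n+q-1)!) · ∑_{l=0}^{q-1} C(n+l-1, l) · x^l`. -/
theorem incomplete_beta_expansion (n q : ℕ) (hn : 1 ≤ n) (hq : 1 ≤ q)
    (x : ℝ) (hx0 : 0 ≤ x) (hx1 : x ≤ 1) :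
    ∫ u in (0 : ℝ)..(1 - x), u ^ (n - 1) * (1 - u) ^ (q - 1) =
      (1 - x) ^ n * (((n - 1)! * (q - 1)! : ℝ) / ((n + q - 1)! : ℝ)) *
        ∑ l ∈ Finset.range q, (Nat.choose (n + l - 1) l : ℝ) * x ^ l := by
  obtain ⟨m, rfl⟩ := Nat.exists_eq_add_of_le' hn
  obtain ⟨p, rfl⟩ := Nat.exists_eq_add_of_le' hq
  have h := intervalIntegral.integral_eq_sub_of_hasDerivAt (a := 0) (b := 1 - x)
    (fun t _ => hasDerivAt_incomplete_beta m p t)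
    (Continuous.intervalIntegrable (by fun_prop) _ _)
  have e1 : m + 1 + (p + 1) - 1 = m + p + 1 := by omega
  have e2 (l : ℕ) : m + 1 + l - 1 = m + l := by omega
  simp only [Nat.add_sub_cancel, e1, e2]
  rw [h]
  simp
end

section
/- For every integer q ≥ 2 and all reals p ≥ 0 and ε > 0, the iterated integral ∫_0^{ε} w^{q+1} ( ∫_{w/ε²}^{1/w} ( ∫_0^{h} (h₁/h)^p · (h - h₁)^{q-2} dh₁ ) dh ) dw equals (q-2)! · ε² / ( 2(q+1) · (p+1)(p+2)⋯(p+q-1) ), where (p+1)(p+2)⋯(p+q-1) denotes the product ∏_{j=1}^{q-1} (p+j). -/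
open scoped Nat

/-- The Beta integral `B(p + 1, n + 1)` over the reals, with one integral parameter. -/
theorem integral_rpow_mul_one_sub_pow {p : ℝ} (hp : -1 < p) (n : ℕ) :
    ∫ x in (0 : ℝ)..1, x ^ p * (1 - x) ^ n =
      (n ! : ℝ) / ∏ j ∈ Finset.Icc 1 (n + 1), (p + j) := by
  have hbeta := Complex.betaIntegral_eval_nat_add_one_right (u := (p : ℂ) + 1)
    (by simpa using by linarith) n
  have hprod : ∏ j ∈ Finset.Icc 1 (n + 1), (p + j) =
      ∏ j ∈ Finset.range (n + 1), (p + 1 + j) := by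
    rw [Finset.range_eq_Ico, ← Finset.Ico_add_one_right_eq_Icc,
      Finset.prod_Ico_eq_prod_range, Finset.prod_Ico_eq_prod_range]
    refine Finset.prod_congr rfl fun j _ => ?_
    push_cast
    ring
  rw [hprod]
  apply Complex.ofReal_injective
  push_cast
  rw [← hbeta, Complex.betaIntegral, ← intervalIntegral.integral_ofReal]
  refine intervalIntegral.integral_congr fun x hx => ?_
  rw [Set.uIcc_of_le zero_le_one] at hx
  simp [Complex.ofReal_cpow hx.1]

theorem integral_div_rpow_mul_sub_pow {p : ℝ} (hp : -1 < p) (n : ℕ) {h : ℝ} (hh : 0 < h) :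
    ∫ x in (0 : ℝ)..h, (x / h) ^ p * (h - x) ^ n =
      h ^ (n + 1) * ((n ! : ℝ) / ∏ j ∈ Finset.Icc 1 (n + 1), (p + j)) := by
  have hscale : ∀ x : ℝ, (x / h) ^ p * (h - x) ^ n =
      h ^ n * ((x / h) ^ p * (1 - x / h) ^ n) := fun x => by
    rw [mul_left_comm, ← mul_pow]
    congr 2
    field_simp
  simp_rw [hscale]
  rw [intervalIntegral.integral_const_mul,
    intervalIntegral.integral_comp_div (fun y => y ^ p * (1 - y) ^ n) hh.ne', zero_div,
    div_self hh.ne', integral_rpow_mul_one_sub_pow hp, smul_eq_mul]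
  ring

/-- For every integer `q ≥ 2` and all reals `p ≥ 0`, `ε > 0`,
`∫_0^{ε} w^{q+1} (∫_{w/ε²}^{1/w} (∫_0^{h} (h₁/h)^p (h-h₁)^{q-2} dh₁) dh) dw
  = (q-2)! ε² / (2(q+1) (p+1)(p+2)⋯(p+q-1))`. -/
theorem cusp_volume_integral (q : ℕ) (hq : 2 ≤ q) (p : ℝ) (hp : 0 ≤ p)
    (ε : ℝ) (hε : 0 < ε) :
    (∫ w in (0 : ℝ)..ε, w ^ (q + 1) *
      ∫ h in (w / ε ^ 2)..(1 / w),
        ∫ h₁ in (0 : ℝ)..h, (h₁ / h) ^ p * (h - h₁) ^ (q - 2)) =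
      ((q - 2)! : ℝ) * ε ^ 2 /
        (2 * (q + 1) * ∏ j ∈ Finset.Icc 1 (q - 1), (p + j)) := by
  obtain ⟨n, rfl⟩ := Nat.exists_eq_add_of_le' hq
  rw [Nat.add_sub_cancel, show n + 2 - 1 = n + 1 by omega]
  have hprod : 0 < ∏ j ∈ Finset.Icc 1 (n + 1), (p + j) := by
    refine Finset.prod_pos fun j hj => ?_
    have : (1 : ℝ) ≤ j := by exact_mod_cast (Finset.mem_Icc.mp hj).1
    linarith
  set B : ℝ := ∏ j ∈ Finset.Icc 1 (n + 1), (p + j) with hB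
  have hq0 : (n : ℝ) + 2 ≠ 0 := by positivity
  have hinner : ∀ w : ℝ, 0 < w →
      w ^ (n + 2 + 1) * (∫ h in (w / ε ^ 2)..(1 / w),
        ∫ h₁ in (0 : ℝ)..h, (h₁ / h) ^ p * (h - h₁) ^ n) =
      n ! / B / (n + 2) * (w - w ^ (2 * n + 5) / ε ^ (2 * n + 4)) := by
    intro w hw
    have hcongr : (∫ h in (w / ε ^ 2)..(1 / w),
        ∫ h₁ in (0 : ℝ)..h, (h₁ / h) ^ p * (h - h₁) ^ n) =
        ∫ h in (w / ε ^ 2)..(1 / w), h ^ (n + 1) * (n ! / B) := by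
      refine intervalIntegral.integral_congr fun h hh => ?_
      have hpos : 0 < h :=
        (lt_min (by positivity : 0 < w / ε ^ 2) (by positivity : 0 < 1 / w)).trans_le hh.1
      exact integral_div_rpow_mul_sub_pow (by linarith) n hpos
    rw [hcongr, intervalIntegral.integral_mul_const, integral_pow]
    push_cast
    rw [show (n : ℝ) + 1 + 1 = n + 2 by ring, div_pow, div_pow]
    field_simp
    ring
  have houter : (∫ w in (0 : ℝ)..ε, w ^ (n + 2 + 1) *
      ∫ h in (w / ε ^ 2)..(1 / w),
        ∫ h₁ in (0 : ℝ)..h, (h₁ / h) ^ p * (h - h₁) ^ n) =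
      ∫ w in (0 : ℝ)..ε, n ! / B / (n + 2) * (w - w ^ (2 * n + 5) / ε ^ (2 * n + 4)) := by
    refine intervalIntegral.integral_congr_ae (Filter.Eventually.of_forall fun w hw => ?_)
    rw [Set.uIoc_of_le hε.le] at hw
    exact hinner w hw.1
  rw [houter, intervalIntegral.integral_const_mul, intervalIntegral.integral_sub
    (Continuous.intervalIntegrable (by fun_prop) _ _)
    (Continuous.intervalIntegrable (by fun_prop) _ _), intervalIntegral.integral_div,
    integral_pow, integral_id]
  have h3 : (n : ℝ) + 3 ≠ 0 := by positivity
  push_cast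
  rw [show (2 * (n : ℝ) + 5 + 1) = 2 * (n + 3) by ring, show (n : ℝ) + 2 + 1 = n + 3 by ring,
    show ε ^ (2 * n + 5 + 1) = ε ^ (2 * n + 4) * ε ^ 2 by ring, zero_pow (by omega)]
  field_simp
  ring
end

section
/- For all integers n ≥ 1, q ≥ 1 and every real p ≥ 0, the iterated integral J_p = ∫_0^{1} s^{2n-1} ( ∫_0^{√(1-s²)} t^{2q+1} · ( t²/(s²+t²) )^{p-1} dt ) ds equals (n-1)! / ( 4(n+q+1) · (p+q)(p+q+1)⋯(p+q+n-1) ), where (p+q)(p+q+1)⋯(p+q+n-1) denotes the product ∏_{j=0}^{n-1} (p+q+j). -/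
open scoped Nat
open MeasureTheory Set Real

lemma integral_cos_pow_mul_sin_rpow_succ (n : ℕ) {a : ℝ} (ha : 1 ≤ a) :
    a * ∫ θ in (0 : ℝ)..π / 2, cos θ ^ (2 * n + 3) * sin θ ^ (2 * a - 1) =
      (n + 1) * ∫ θ in (0 : ℝ)..π / 2, cos θ ^ (2 * n + 1) * sin θ ^ (2 * (a + 1) - 1) := by
  have hc : ∀ b : ℝ, 0 ≤ b → Continuous fun θ ↦ sin θ ^ b := fun b hb ↦
    continuous_sin.rpow_const fun _ ↦ Or.inr hb
  have h1 : IntervalIntegrable (fun θ ↦ cos θ ^ (2 * n + 3) * sin θ ^ (2 * a - 1))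
      volume 0 (π / 2) :=
    ((continuous_cos.pow _).mul (hc _ (by linarith))).intervalIntegrable _ _
  have h2 : IntervalIntegrable (fun θ ↦ cos θ ^ (2 * n + 1) * sin θ ^ (2 * (a + 1) - 1))
      volume 0 (π / 2) :=
    ((continuous_cos.pow _).mul (hc _ (by linarith))).intervalIntegrable _ _
  have hd : ∀ θ ∈ uIcc 0 (π / 2), HasDerivAt (fun θ ↦ cos θ ^ (2 * n + 2) * sin θ ^ (2 * a))
      (2 * a * (cos θ ^ (2 * n + 3) * sin θ ^ (2 * a - 1)) -
        2 * (n + 1) * (cos θ ^ (2 * n + 1) * sin θ ^ (2 * (a + 1) - 1))) θ := by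
    intro θ hθ
    rw [uIcc_of_le (by positivity)] at hθ
    have hs : 0 ≤ sin θ := sin_nonneg_of_nonneg_of_le_pi hθ.1 (by linarith [hθ.2, pi_pos])
    have hd := ((hasDerivAt_cos θ).pow (2 * n + 2)).mul
      ((hasDerivAt_sin θ).rpow_const (p := 2 * a) (Or.inr (by linarith)))
    refine hd.congr_deriv ?_
    have e : sin θ ^ (2 * (a + 1) - 1) = sin θ * sin θ ^ (2 * a) := by
      rw [show 2 * (a + 1) - 1 = 1 + 2 * a by ring, rpow_add_of_nonneg hs (by norm_num)
        (by linarith), rpow_one]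
    rw [e]
    simp only [Pi.pow_apply, show 2 * n + 2 - 1 = 2 * n + 1 by omega]
    push_cast
    ring
  have key := intervalIntegral.integral_eq_sub_of_hasDerivAt hd
    ((h1.const_mul _).sub (h2.const_mul _))
  rw [intervalIntegral.integral_sub (h1.const_mul _) (h2.const_mul _),
    intervalIntegral.integral_const_mul, intervalIntegral.integral_const_mul] at key
  simp [zero_rpow (show 2 * a ≠ 0 by linarith)] at key
  linarith

lemma integral_cos_pow_mul_sin_rpow (n : ℕ) {a : ℝ} (ha : 1 ≤ a) :
    ∫ θ in (0 : ℝ)..π / 2, cos θ ^ (2 * n + 1) * sin θ ^ (2 * a - 1) =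
      (n ! : ℝ) / (2 * ∏ j ∈ Finset.range (n + 1), (a + j)) := by
  induction n generalizing a with
  | zero =>
    have hd : ∀ θ ∈ uIcc 0 (π / 2), HasDerivAt (fun θ ↦ sin θ ^ (2 * a) / (2 * a))
        (cos θ ^ (2 * 0 + 1) * sin θ ^ (2 * a - 1)) θ := by
      intro θ _
      refine (((hasDerivAt_sin θ).rpow_const (p := 2 * a)
        (Or.inr (by linarith))).div_const (2 * a)).congr_deriv ?_
      field_simp
      ring
    rw [intervalIntegral.integral_eq_sub_of_hasDerivAt hd
      (((continuous_cos.pow _).mul (continuous_sin.rpow_const fun _ ↦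
        Or.inr (by linarith))).intervalIntegrable _ _)]
    simp [zero_rpow (show 2 * a ≠ 0 by linarith)]
  | succ n ih =>
    have h := integral_cos_pow_mul_sin_rpow_succ n ha
    rw [ih (by linarith)] at h
    have hP : ∏ j ∈ Finset.range (n + 1), (a + 1 + j) ≠ 0 :=
      Finset.prod_ne_zero_iff.2 fun j _ ↦ by positivity
    rw [Finset.prod_range_succ', show 2 * (n + 1) + 1 = 2 * n + 3 by ring]
    have e : ∏ j ∈ Finset.range (n + 1), (a + ((j + 1 : ℕ) : ℝ)) =
        ∏ j ∈ Finset.range (n + 1), (a + 1 + j) :=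
      Finset.prod_congr rfl fun j _ ↦ by push_cast; ring
    have ha0 : a ≠ 0 := by positivity
    rw [e, Nat.factorial_succ, ← mul_right_inj' ha0, h]
    push_cast
    field_simp
    simp

/-- The part of the open unit disc lying in the open first quadrant. -/
def quarterDisc : Set (ℝ × ℝ) := {x | 0 < x.1 ∧ 0 < x.2 ∧ x.1 ^ 2 + x.2 ^ 2 < 1}

lemma measurableSet_quarterDisc : MeasurableSet quarterDisc :=
  (measurableSet_lt measurable_const measurable_fst).inter
    ((measurableSet_lt measurable_const measurable_snd).inter
      (measurableSet_lt ((measurable_fst.pow_const 2).add (measurable_snd.pow_const 2))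
        measurable_const))

lemma quarterDisc_subset : quarterDisc ⊆ Ioo 0 1 ×ˢ Ioo 0 1 := fun x hx ↦
  ⟨⟨hx.1, by nlinarith [hx.1, hx.2.1, hx.2.2]⟩, hx.2.1, by nlinarith [hx.1, hx.2.1, hx.2.2]⟩

lemma polarCoord_symm_mem_quarterDisc_iff {r θ : ℝ} (hr : 0 < r) (hθ : θ ∈ Ioo (-π) π) :
    (r * cos θ, r * sin θ) ∈ quarterDisc ↔ (r, θ) ∈ Ioo (0 : ℝ) 1 ×ˢ Ioo 0 (π / 2) := by
  have e : (r * cos θ) ^ 2 + (r * sin θ) ^ 2 = r ^ 2 := by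
    linear_combination r ^ 2 * cos_sq_add_sin_sq θ
  simp only [quarterDisc, mem_ofPred_eq, e, mul_pos_iff_of_pos_left hr, mem_prod, mem_Ioo, hr,
    true_and]
  constructor
  · rintro ⟨hc, hs, h1⟩
    refine ⟨by nlinarith, ?_, ?_⟩
    · by_contra! h
      exact hs.not_ge (sin_nonpos_of_nonpos_of_neg_pi_le h hθ.1.le)
    · by_contra! h
      exact hc.not_ge (cos_nonpos_of_pi_div_two_le_of_le h (by linarith [hθ.2, pi_pos]))
  · rintro ⟨h1, h0, h2⟩
    exact ⟨cos_pos_of_mem_Ioo ⟨by linarith, h2⟩, sin_pos_of_pos_of_lt_pi h0 hθ.2, by nlinarith⟩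

/-- The density `s ^ k * t ^ (2 * q + 1) * (t ^ 2 / (s ^ 2 + t ^ 2)) ^ b`. -/
noncomputable def areaDensity (k q : ℕ) (b : ℝ) (x : ℝ × ℝ) : ℝ :=
  x.1 ^ k * (x.2 ^ (2 * q + 1) * (x.2 ^ 2 / (x.1 ^ 2 + x.2 ^ 2)) ^ b)

lemma norm_areaDensity_le_one {k q : ℕ} {b : ℝ} (hq : 1 ≤ q) (hb : -1 ≤ b) {x : ℝ × ℝ}
    (hx : x ∈ quarterDisc) : ‖areaDensity k q b x‖ ≤ 1 := by
  obtain ⟨s, t⟩ := x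
  obtain ⟨⟨hs, hs1⟩, -, ht1⟩ := quarterDisc_subset hx
  obtain ⟨-, ht, h⟩ := hx
  simp only [areaDensity] at *
  have hst : 0 < s ^ 2 + t ^ 2 := by positivity
  have hu1 : t ^ 2 / (s ^ 2 + t ^ 2) ≤ 1 := (div_le_one hst).2 (by nlinarith)
  rw [norm_of_nonneg (by positivity)]
  refine mul_le_one₀ (pow_le_one₀ hs.le hs1.le) (by positivity) ?_
  calc t ^ (2 * q + 1) * (t ^ 2 / (s ^ 2 + t ^ 2)) ^ b
      ≤ t ^ 2 * (t ^ 2 / (s ^ 2 + t ^ 2)) ^ (-1 : ℝ) := by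
        refine mul_le_mul (pow_le_pow_of_le_one ht.le ht1.le (by omega))
          (rpow_le_rpow_of_exponent_ge (by positivity) hu1 hb) (by positivity) (by positivity)
    _ = s ^ 2 + t ^ 2 := by rw [rpow_neg_one]; field_simp
    _ ≤ 1 := h.le

lemma integrable_indicator_areaDensity {k q : ℕ} {b : ℝ} (hq : 1 ≤ q) (hb : -1 ≤ b) :
    Integrable (quarterDisc.indicator (areaDensity k q b)) := by
  have hm : Measurable (areaDensity k q b) := by unfold areaDensity; fun_prop
  rw [integrable_indicator_iff measurableSet_quarterDisc]
  refine IntegrableOn.of_bound ?_ hm.aestronglyMeasurable 1 ?_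
  · refine (measure_mono quarterDisc_subset).trans_lt ?_
    rw [Measure.volume_eq_prod, Measure.prod_prod]
    simp
  · exact (ae_restrict_iff' measurableSet_quarterDisc).2
      (ae_of_all _ fun x hx ↦ norm_areaDensity_le_one hq hb hx)

lemma integral_integral_eq_integral_quarterDisc {k q : ℕ} {b : ℝ} (hq : 1 ≤ q) (hb : -1 ≤ b) :
    ∫ s in (0 : ℝ)..1, s ^ k * ∫ t in (0 : ℝ)..√(1 - s ^ 2),
        t ^ (2 * q + 1) * (t ^ 2 / (s ^ 2 + t ^ 2)) ^ b =
      ∫ x, quarterDisc.indicator (areaDensity k q b) x := by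
  rw [Measure.volume_eq_prod, integral_prod _ (integrable_indicator_areaDensity hq hb),
    intervalIntegral.integral_of_le zero_le_one, ← integral_indicator measurableSet_Ioc]
  congr 1 with s
  by_cases hs : s ∈ Ioc (0 : ℝ) 1
  · rw [indicator_of_mem hs, intervalIntegral.integral_of_le (sqrt_nonneg _),
      integral_Ioc_eq_integral_Ioo, ← integral_const_mul, ← integral_indicator measurableSet_Ioo]
    congr 1 with t
    have : t ∈ Ioo 0 √(1 - s ^ 2) ↔ (s, t) ∈ quarterDisc := by
      simp only [mem_Ioo, quarterDisc, mem_ofPred_eq, hs.1, true_and]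
      refine and_congr_right fun ht ↦ ?_
      rw [lt_sqrt ht.le, lt_sub_iff_add_lt, add_comm]
    by_cases ht : (s, t) ∈ quarterDisc
    · rw [indicator_of_mem (this.2 ht), indicator_of_mem ht, areaDensity]
    · rw [indicator_of_notMem (mt this.1 ht), indicator_of_notMem ht]
  · rw [indicator_of_notMem hs]
    refine (integral_eq_zero_of_ae (ae_of_all _ fun t ↦ indicator_of_notMem (fun h ↦ hs ?_) _)).symm
    exact Ioo_subset_Ioc_self (quarterDisc_subset h).1

lemma areaDensity_polar {k q : ℕ} {b r θ : ℝ} (hr : 0 < r) (hs : 0 < sin θ) :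
    r * areaDensity k q b (r * cos θ, r * sin θ) =
      r ^ (k + 2 * q + 2) * (cos θ ^ k * sin θ ^ (2 * (b + 1 + q) - 1)) := by
  have e : (r * sin θ) ^ 2 / ((r * cos θ) ^ 2 + (r * sin θ) ^ 2) = sin θ ^ 2 := by
    rw [show (r * cos θ) ^ 2 + (r * sin θ) ^ 2 = r ^ 2 by
      linear_combination r ^ 2 * cos_sq_add_sin_sq θ]
    field_simp
  have e' : sin θ ^ (2 * (b + 1 + q) - 1) = sin θ ^ (2 * q + 1) * (sin θ ^ 2) ^ b := by
    rw [← rpow_natCast, ← rpow_natCast (sin θ) 2, ← rpow_mul hs.le, ← rpow_add hs]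
    congr 1
    push_cast
    ring
  simp only [areaDensity, e, e']
  ring

lemma integral_quarterDisc_areaDensity (k q : ℕ) (b : ℝ) :
    ∫ x, quarterDisc.indicator (areaDensity k q b) x =
      1 / (k + 2 * q + 3) *
        ∫ θ in (0 : ℝ)..π / 2, cos θ ^ k * sin θ ^ (2 * (b + 1 + q) - 1) := by
  have hR : MeasurableSet (Ioo (0 : ℝ) 1 ×ˢ Ioo 0 (π / 2)) :=
    measurableSet_Ioo.prod measurableSet_Ioo
  have hsub : Ioo (0 : ℝ) 1 ×ˢ Ioo 0 (π / 2) ⊆ polarCoord.target := fun x hx ↦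
    ⟨hx.1.1, by linarith [hx.2.1, pi_pos], by linarith [hx.2.2, pi_pos]⟩
  have h : ∀ x ∈ polarCoord.target,
      x.1 • quarterDisc.indicator (areaDensity k q b) (polarCoord.symm x) =
        (Ioo (0 : ℝ) 1 ×ˢ Ioo 0 (π / 2)).indicator (fun x ↦ x.1 ^ (k + 2 * q + 2) *
          (cos x.2 ^ k * sin x.2 ^ (2 * (b + 1 + q) - 1))) x := by
    rintro ⟨r, θ⟩ ⟨hr, hθ⟩
    have hiff := polarCoord_symm_mem_quarterDisc_iff hr hθ
    change r * quarterDisc.indicator _ (r * cos θ, r * sin θ) = _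
    by_cases hx : (r, θ) ∈ Ioo (0 : ℝ) 1 ×ˢ Ioo 0 (π / 2)
    · rw [indicator_of_mem hx, indicator_of_mem (hiff.2 hx),
        areaDensity_polar hr (sin_pos_of_pos_of_lt_pi hx.2.1 hθ.2)]
    · rw [indicator_of_notMem hx, indicator_of_notMem (mt hiff.1 hx), mul_zero]
  rw [← integral_comp_polarCoord_symm,
    setIntegral_congr_fun polarCoord.open_target.measurableSet h, setIntegral_indicator hR,
    inter_eq_self_of_subset_right hsub, Measure.volume_eq_prod,
    setIntegral_prod_mul (fun r : ℝ ↦ r ^ (k + 2 * q + 2))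
      (fun θ : ℝ ↦ cos θ ^ k * sin θ ^ (2 * (b + 1 + q) - 1)),
    ← integral_Ioc_eq_integral_Ioo, ← integral_Ioc_eq_integral_Ioo,
    ← intervalIntegral.integral_of_le zero_le_one,
    ← intervalIntegral.integral_of_le (by positivity), integral_pow]
  congr 1
  push_cast
  norm_num
  ring

/-- For all integers `n ≥ 1`, `q ≥ 1` and every real `p ≥ 0`,
`J_p = ∫_0^1 s^{2n-1} (∫_0^{√(1-s²)} t^{2q+1} (t²/(s²+t²))^{p-1} dt) ds
  = (n-1)! / (4(n+q+1) (p+q)(p+q+1)⋯(p+q+n-1))`. -/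
theorem Jp_integral (n q : ℕ) (hn : 1 ≤ n) (hq : 1 ≤ q) (p : ℝ) (hp : 0 ≤ p) :
    (∫ s in (0 : ℝ)..1, s ^ (2 * n - 1) *
      ∫ t in (0 : ℝ)..Real.sqrt (1 - s ^ 2),
        t ^ (2 * q + 1) * (t ^ 2 / (s ^ 2 + t ^ 2)) ^ (p - 1)) =
      ((n - 1)! : ℝ) /
        (4 * (n + q + 1) * ∏ j ∈ Finset.range n, (p + q + j)) := by
  obtain ⟨m, rfl⟩ := Nat.exists_eq_add_of_le' hn
  have hq' : (1 : ℝ) ≤ q := by exact_mod_cast hq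
  rw [integral_integral_eq_integral_quarterDisc hq (by linarith),
    integral_quarterDisc_areaDensity, show 2 * (m + 1) - 1 = 2 * m + 1 by omega,
    sub_add_cancel, integral_cos_pow_mul_sin_rpow m (by linarith : 1 ≤ p + q),
    Nat.add_sub_cancel, div_mul_div_comm, one_mul]
  congr 1
  push_cast
  ring
end

section
/- For all integers n ≥ 1, q ≥ 1 and every real x with 0 ≤ x < 1, the iterated integral I_x = ∫_0^{√(1-x)} s^{2n-1} ( ∫_{s·√(x/(1-x))}^{√(1-s²)} t^{2q+1} · (s²+t²)/t² dt ) ds equals (1/(4(n+q+1))) · ∫_0^{1-x} u^{n-1}(1-u)^{q-1} du. -/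
lemma inner_integral (p : ℕ) (s a b : ℝ) :
    (∫ t in a..b, t ^ (2 * (p + 1) + 1) * (s ^ 2 + t ^ 2) / t ^ 2) =
      (s ^ 2 * (b ^ 2) ^ (p + 1) / (2 * (p + 1)) + (b ^ 2) ^ (p + 2) / (2 * (p + 2))) -
      (s ^ 2 * (a ^ 2) ^ (p + 1) / (2 * (p + 1)) + (a ^ 2) ^ (p + 2) / (2 * (p + 2))) := by
  have hp1 : (p : ℝ) + 1 ≠ 0 := by positivity
  have hp2 : (p : ℝ) + 2 ≠ 0 := by positivity
  have hcongr : ∀ t : ℝ, t ^ (2 * (p + 1) + 1) * (s ^ 2 + t ^ 2) / t ^ 2 =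
      t ^ (2 * p + 1) * (s ^ 2 + t ^ 2) := by
    intro t
    rcases eq_or_ne t 0 with rfl | ht
    · simp
    · field_simp
      ring
  simp only [hcongr]
  refine intervalIntegral.integral_eq_sub_of_hasDerivAt
    (f := fun t : ℝ => s ^ 2 * (t ^ 2) ^ (p + 1) / (2 * (p + 1)) + (t ^ 2) ^ (p + 2) / (2 * (p + 2)))
    (fun t _ => ?_) (Continuous.intervalIntegrable (by fun_prop) _ _)
  have h := hasDerivAt_pow 2 t
  refine ((((h.pow (p + 1)).const_mul (s ^ 2)).div_const (2 * ((p : ℝ) + 1))).add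
    ((h.pow (p + 2)).div_const (2 * ((p : ℝ) + 2)))).congr_deriv ?_
  simp only [Nat.add_sub_cancel, show p + 2 - 1 = p + 1 from rfl]
  push_cast
  field_simp
  ring

/-- The primitive behind the integration by parts relating the outer integrand, after the
substitution `u = s ^ 2`, to the incomplete Beta integrand. -/
lemma hasDerivAt_beta_primitive (m p : ℕ) (K u : ℝ) :
    HasDerivAt (fun u : ℝ => (u ^ (m + 1) * (1 - u) ^ (p + 1) * ((u + (p + 1)) /
        (2 * (p + 1) * (p + 2))) - K * u ^ (m + p + 3)) / (m + p + 3))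
      (u ^ m * (u * (1 - u) ^ (p + 1) / (2 * (p + 1)) + (1 - u) ^ (p + 2) / (2 * (p + 2)) -
        K * u ^ (p + 2)) - 1 / (2 * (m + p + 3)) * (u ^ m * (1 - u) ^ p)) u := by
  have hp1 : (p : ℝ) + 1 ≠ 0 := by positivity
  have hp2 : (p : ℝ) + 2 ≠ 0 := by positivity
  have hN : (m : ℝ) + p + 3 ≠ 0 := by positivity
  have h1 := hasDerivAt_pow (m + 1) u
  have h2 := ((hasDerivAt_id u).const_sub 1).pow (p + 1)
  have h3 := ((hasDerivAt_id u).add_const ((p : ℝ) + 1)).div_const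
    (2 * ((p : ℝ) + 1) * (p + 2))
  have h4 := (hasDerivAt_pow (m + p + 3) u).const_mul K
  refine ((((h1.mul h2).mul h3).sub h4).div_const ((m : ℝ) + p + 3)).congr_deriv ?_
  simp only [Nat.add_sub_cancel, show m + p + 3 - 1 = m + p + 2 from rfl, id, Pi.pow_apply,
    Pi.mul_apply]
  push_cast
  field_simp
  ring

/-- For all integers `n ≥ 1`, `q ≥ 1` and every real `x` with `0 ≤ x < 1`,
`I_x = ∫_0^{√(1-x)} s^{2n-1} (∫_{s√(x/(1-x))}^{√(1-s²)} t^{2q+1} (s²+t²)/t² dt) ds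
  = (1/(4(n+q+1))) ∫_0^{1-x} u^{n-1}(1-u)^{q-1} du`. -/
theorem Ix_integral (n q : ℕ) (hn : 1 ≤ n) (hq : 1 ≤ q)
    (x : ℝ) (hx0 : 0 ≤ x) (hx1 : x < 1) :
    (∫ s in (0 : ℝ)..Real.sqrt (1 - x), s ^ (2 * n - 1) *
      ∫ t in (s * Real.sqrt (x / (1 - x)))..Real.sqrt (1 - s ^ 2),
        t ^ (2 * q + 1) * (s ^ 2 + t ^ 2) / t ^ 2) =
      (1 / (4 * ((n : ℝ) + q + 1))) *
        ∫ u in (0 : ℝ)..(1 - x), u ^ (n - 1) * (1 - u) ^ (q - 1) := by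
  obtain ⟨m, rfl⟩ := Nat.exists_eq_add_of_le' hn
  obtain ⟨p, rfl⟩ := Nat.exists_eq_add_of_le' hq
  have hy : 0 < 1 - x := by linarith
  have hp1 : (p : ℝ) + 1 ≠ 0 := by positivity
  have hp2 : (p : ℝ) + 2 ≠ 0 := by positivity
  have hN : (m : ℝ) + p + 3 ≠ 0 := by positivity
  set c := x / (1 - x) with hc
  have hc0 : 0 ≤ c := div_nonneg hx0 hy.le
  set K := c ^ (p + 1) / (2 * (p + 1)) + c ^ (p + 2) / (2 * (p + 2)) with hK
  let g : ℝ → ℝ := fun u => u ^ m * (u * (1 - u) ^ (p + 1) / (2 * (p + 1)) +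
    (1 - u) ^ (p + 2) / (2 * (p + 2)) - K * u ^ (p + 2))
  have hg : Continuous g := by fun_prop
  have houter : (∫ s in (0 : ℝ)..Real.sqrt (1 - x), s ^ (2 * (m + 1) - 1) *
      ∫ t in (s * Real.sqrt c)..Real.sqrt (1 - s ^ 2),
        t ^ (2 * (p + 1) + 1) * (s ^ 2 + t ^ 2) / t ^ 2) =
      1 / 2 * ∫ u in (0 : ℝ)..(1 - x), g u := by
    have hsub := intervalIntegral.integral_comp_mul_deriv (a := 0) (b := Real.sqrt (1 - x))
      (f := fun s : ℝ => s ^ 2) (f' := fun s => 2 * s) (g := g)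
      (fun s _ => by simpa using hasDerivAt_pow 2 s) (by fun_prop) hg
    simp only [Real.sq_sqrt hy.le, zero_pow two_ne_zero] at hsub
    rw [← hsub, ← intervalIntegral.integral_const_mul]
    refine intervalIntegral.integral_congr fun s hs => ?_
    rw [Set.uIcc_of_le (Real.sqrt_nonneg _)] at hs
    have hs1 : 0 ≤ 1 - s ^ 2 := by
      have := (Real.le_sqrt hs.1 hy.le).1 hs.2
      linarith
    simp only [inner_integral, mul_pow, Real.sq_sqrt hc0, Real.sq_sqrt hs1, Function.comp, g, hK,
      show 2 * (m + 1) - 1 = 2 * m + 1 by omega]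
    ring
  have hbeta : (∫ u in (0 : ℝ)..(1 - x),
      (g u - 1 / (2 * (m + p + 3)) * (u ^ m * (1 - u) ^ p))) = 0 := by
    rw [intervalIntegral.integral_eq_sub_of_hasDerivAt
      (fun u _ => hasDerivAt_beta_primitive m p K u)
      (Continuous.intervalIntegrable (by fun_prop) _ _)]
    have hKx : K * (1 - x) ^ (p + 2) =
        x ^ (p + 1) * ((1 - x + (p + 1)) / (2 * (p + 1) * (p + 2))) := by
      rw [hK, hc, div_pow, div_pow]
      field_simp
      ring
    have hKN : K * (1 - x) ^ (m + p + 3) = (1 - x) ^ (m + 1) * (K * (1 - x) ^ (p + 2)) := by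
      ring
    rw [hKN, hKx]
    simp only [sub_sub_cancel, zero_pow (Nat.succ_ne_zero _)]
    ring
  rw [intervalIntegral.integral_sub (hg.intervalIntegrable _ _)
    (Continuous.intervalIntegrable (by fun_prop) _ _), sub_eq_zero,
    intervalIntegral.integral_const_mul] at hbeta
  rw [houter, hbeta]
  simp only [Nat.add_sub_cancel]
  push_cast
  rw [← mul_assoc]
  congr 1
  field_simp
  ring
end

section
/- For all integers n ≥ 1, q ≥ 1 and every real x with 0 ≤ x < 1, the iterated integral I'_x = ∫_0^{√(1-x)} s^{2n-1} ( ∫_{s·√(x/(1-x))}^{√(1-s²)} t^{2q+1} · ( 1 - x·(s²+t²)/t² )^{q-1} · (s²+t²)/t² dt ) ds equals (1-x)^{n+q-1} · (n-1)!·(q-1)! / ( 4(n+q+1) · (n+q-1)! ). -/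
open scoped Nat

/-- A Beta integral in the variable `s ^ 2`. -/
theorem integral_pow_mul_sub_sq_pow {c : ℝ} (hc : 0 ≤ c) (m q : ℕ) :
    (∫ s in (0 : ℝ)..Real.sqrt c, s ^ (2 * m + 1) * (c - s ^ 2) ^ q) =
      c ^ (m + q + 1) * (m ! : ℝ) * (q ! : ℝ) / (2 * ((m + q + 1)! : ℝ)) := by
  induction m generalizing q with
  | zero =>
    have hderiv : ∀ s : ℝ, HasDerivAt (fun s : ℝ => -(c - s ^ 2) ^ (q + 1) / (2 * (q + 1)))
        (s ^ (2 * 0 + 1) * (c - s ^ 2) ^ q) s := by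
      intro s
      have h := ((((hasDerivAt_pow 2 s).const_sub c).pow (q + 1)).neg).div_const
        (2 * ((q : ℝ) + 1))
      refine h.congr_deriv ?_
      push_cast
      field_simp
    rw [intervalIntegral.integral_eq_sub_of_hasDerivAt (fun s _ => hderiv s)
      (Continuous.intervalIntegrable (by fun_prop) _ _)]
    rw [Real.sq_sqrt hc]
    simp only [zero_add, Nat.factorial_succ, Nat.factorial_zero]
    have : (q ! : ℝ) ≠ 0 := by positivity
    push_cast
    field_simp
    simp
  | succ m ih =>
    have hderiv : ∀ s : ℝ, HasDerivAt (fun s : ℝ => s ^ (2 * m + 2) * (c - s ^ 2) ^ (q + 1))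
        ((2 * m + 2) * (s ^ (2 * m + 1) * (c - s ^ 2) ^ (q + 1)) -
          2 * (q + 1) * (s ^ (2 * (m + 1) + 1) * (c - s ^ 2) ^ q)) s := by
      intro s
      have h := (hasDerivAt_pow (2 * m + 2) s).mul
        (((hasDerivAt_pow 2 s).const_sub c).pow (q + 1))
      refine h.congr_deriv ?_
      push_cast [Pi.pow_apply]
      ring
    have h := intervalIntegral.integral_eq_sub_of_hasDerivAt (a := 0) (b := Real.sqrt c)
      (fun s _ => hderiv s) (Continuous.intervalIntegrable (by fun_prop) _ _)
    rw [intervalIntegral.integral_sub (Continuous.intervalIntegrable (by fun_prop) _ _)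
      (Continuous.intervalIntegrable (by fun_prop) _ _), intervalIntegral.integral_const_mul,
      intervalIntegral.integral_const_mul, ih, Real.sq_sqrt hc] at h
    simp only [sub_self, zero_pow (Nat.succ_ne_zero _), mul_zero, zero_mul] at h
    have hq : (2 * ((q : ℝ) + 1)) ≠ 0 := by positivity
    apply mul_left_cancel₀ hq
    rw [← sub_eq_zero.mp h, show m + 1 + q + 1 = m + (q + 1) + 1 by ring,
      Nat.factorial_succ m, Nat.factorial_succ q]
    push_cast
    ring

/-- The inner integral, after clearing the denominators `t ^ 2`. -/
theorem integral_mul_sub_sq_pow_mul_add_sq {x s : ℝ} (hx0 : 0 ≤ x) (hx1 : x < 1)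
    (hs : s ^ 2 ≤ 1) (p : ℕ) :
    (∫ t in (s * Real.sqrt (x / (1 - x)))..Real.sqrt (1 - s ^ 2),
        t * ((1 - x) * t ^ 2 - x * s ^ 2) ^ p * (s ^ 2 + t ^ 2)) =
      (1 - x - s ^ 2) ^ (p + 1) / (2 * (1 - x) * (p + 1)) -
        (1 - x - s ^ 2) ^ (p + 2) / (2 * (1 - x) ^ 2 * (p + 1) * (p + 2)) := by
  have hc : 1 - x ≠ 0 := by linarith
  have hderiv : ∀ t : ℝ, HasDerivAt (fun t : ℝ =>
      ((1 - x) * t ^ 2 - x * s ^ 2) ^ (p + 1) * (s ^ 2 + t ^ 2) / (2 * (1 - x) * (p + 1)) -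
        ((1 - x) * t ^ 2 - x * s ^ 2) ^ (p + 2) / (2 * (1 - x) ^ 2 * (p + 1) * (p + 2)))
      (t * ((1 - x) * t ^ 2 - x * s ^ 2) ^ p * (s ^ 2 + t ^ 2)) t := by
    intro t
    have hA := ((hasDerivAt_pow 2 t).const_mul (1 - x)).sub_const (x * s ^ 2)
    have h := (((hA.pow (p + 1)).mul ((hasDerivAt_pow 2 t).const_add (s ^ 2))).div_const
      (2 * (1 - x) * ((p : ℝ) + 1))).sub
      ((hA.pow (p + 2)).div_const (2 * (1 - x) ^ 2 * ((p : ℝ) + 1) * (p + 2)))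
    refine h.congr_deriv ?_
    push_cast
    simp only [Pi.pow_apply]
    have h1 : (p : ℝ) + 1 ≠ 0 := by positivity
    have h2 : (p : ℝ) + 2 ≠ 0 := by positivity
    field_simp
    ring
  have hA₁ : (1 - x) * (1 - s ^ 2) - x * s ^ 2 = 1 - x - s ^ 2 := by ring
  have hA₀ : (1 - x) * (s ^ 2 * (x / (1 - x))) - x * s ^ 2 = 0 := by field_simp; ring
  rw [intervalIntegral.integral_eq_sub_of_hasDerivAt (fun t _ => hderiv t)
    (Continuous.intervalIntegrable (by fun_prop) _ _), Real.sq_sqrt (by linarith), mul_pow,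
    Real.sq_sqrt (div_nonneg hx0 (by linarith)), hA₁, hA₀]
  simp

/-- For all integers `n ≥ 1`, `q ≥ 1` and every real `x` with `0 ≤ x < 1`,
`I'_x = ∫_0^{√(1-x)} s^{2n-1} (∫_{s√(x/(1-x))}^{√(1-s²)}
          t^{2q+1} (1 - x(s²+t²)/t²)^{q-1} (s²+t²)/t² dt) ds
  = (1-x)^{n+q-1} (n-1)!(q-1)! / (4(n+q+1)(n+q-1)!)`. -/
theorem Ix'_integral (n q : ℕ) (hn : 1 ≤ n) (hq : 1 ≤ q)
    (x : ℝ) (hx0 : 0 ≤ x) (hx1 : x < 1) :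
    (∫ s in (0 : ℝ)..Real.sqrt (1 - x), s ^ (2 * n - 1) *
      ∫ t in (s * Real.sqrt (x / (1 - x)))..Real.sqrt (1 - s ^ 2),
        t ^ (2 * q + 1) * (1 - x * (s ^ 2 + t ^ 2) / t ^ 2) ^ (q - 1) *
          ((s ^ 2 + t ^ 2) / t ^ 2)) =
      (1 - x) ^ (n + q - 1) * ((n - 1)! : ℝ) * ((q - 1)! : ℝ) /
        (4 * ((n : ℝ) + q + 1) * ((n + q - 1)! : ℝ)) := by
  obtain ⟨m, rfl⟩ := Nat.exists_eq_add_of_le' hn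
  obtain ⟨p, rfl⟩ := Nat.exists_eq_add_of_le' hq
  have hc : 0 < 1 - x := by linarith
  have hint : ∀ s t : ℝ, t ^ (2 * (p + 1) + 1) * (1 - x * (s ^ 2 + t ^ 2) / t ^ 2) ^ p *
      ((s ^ 2 + t ^ 2) / t ^ 2) =
        t * ((1 - x) * t ^ 2 - x * s ^ 2) ^ p * (s ^ 2 + t ^ 2) := by
    intro s t
    rcases eq_or_ne t 0 with rfl | ht
    · simp
    · have h : (1 - x) * t ^ 2 - x * s ^ 2 = t ^ 2 * (1 - x * (s ^ 2 + t ^ 2) / t ^ 2) := by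
        field_simp
        ring
      rw [h, mul_pow]
      field_simp
      ring
  simp only [Nat.add_sub_cancel, hint, show 2 * (m + 1) - 1 = 2 * m + 1 by omega,
    show m + 1 + (p + 1) - 1 = m + p + 1 by omega]
  have houter : (∫ s in (0 : ℝ)..Real.sqrt (1 - x), s ^ (2 * m + 1) *
      ∫ t in (s * Real.sqrt (x / (1 - x)))..Real.sqrt (1 - s ^ 2),
        t * ((1 - x) * t ^ 2 - x * s ^ 2) ^ p * (s ^ 2 + t ^ 2)) =
      ∫ s in (0 : ℝ)..Real.sqrt (1 - x),
        ((2 * (1 - x) * (p + 1))⁻¹ * (s ^ (2 * m + 1) * (1 - x - s ^ 2) ^ (p + 1)) -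
        (2 * (1 - x) ^ 2 * (p + 1) * (p + 2))⁻¹ *
          (s ^ (2 * m + 1) * (1 - x - s ^ 2) ^ (p + 2))) := by
    apply intervalIntegral.integral_congr
    intro s hs
    rw [Set.uIcc_of_le (Real.sqrt_nonneg _)] at hs
    have hs2 : s ^ 2 ≤ 1 := by
      have := pow_le_pow_left₀ hs.1 hs.2 2
      rw [Real.sq_sqrt hc.le] at this
      linarith
    simp only [integral_mul_sub_sq_pow_mul_add_sq hx0 hx1 hs2 p]
    ring
  rw [houter, intervalIntegral.integral_sub (Continuous.intervalIntegrable (by fun_prop) _ _)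
      (Continuous.intervalIntegrable (by fun_prop) _ _), intervalIntegral.integral_const_mul,
      intervalIntegral.integral_const_mul, integral_pow_mul_sub_sq_pow hc.le,
      integral_pow_mul_sub_sq_pow hc.le, show m + (p + 1) + 1 = m + p + 1 + 1 by ring,
      show m + (p + 2) + 1 = m + p + 1 + 1 + 1 by ring, Nat.factorial_succ (m + p + 1 + 1),
      Nat.factorial_succ (m + p + 1), Nat.factorial_succ (p + 1), Nat.factorial_succ p]
  have hf : ((m + p + 1)! : ℝ) ≠ 0 := by positivity
  push_cast
  have h1 : (p : ℝ) + 1 ≠ 0 := by positivity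
  have h2 : (p : ℝ) + 2 ≠ 0 := by positivity
  have h3 : (m : ℝ) + p + 1 + 1 ≠ 0 := by positivity
  have h4 : (m : ℝ) + p + 1 + 1 + 1 ≠ 0 := by positivity
  have h5 : (m : ℝ) + 1 + (p + 1) + 1 ≠ 0 := by positivity
  field_simp
  ring
end

section
/- For every integer q ≥ 3, all reals h > 0, x, a, a₁ with 0 ≤ x < 1, x ≤ a ≤ 1, a₁ ≥ 0 and (1-x)·a₁ ≤ 1-a, the iterated integral ∫_{a₁·h}^{((1-a)/(1-x))·h} ( ∫_{a·h - x·h₁}^{h - h₁} (h - h₁ - h₂)^{q-3} dh₂ ) dh₁ equals (q-3)! · ( (1-a) - (1-x)·a₁ )^{q-1} · h^{q-1} / ( (1-x) · (q-1)! ). -/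
open scoped Nat

/-- For every integer `q ≥ 3` and reals `h > 0`, `0 ≤ x < 1`, `x ≤ a ≤ 1`, `a₁ ≥ 0`
with `(1-x)a₁ ≤ 1-a`,
`∫_{a₁h}^{((1-a)/(1-x))h} (∫_{ah - xh₁}^{h - h₁} (h - h₁ - h₂)^{q-3} dh₂) dh₁
  = (q-3)! ((1-a) - (1-x)a₁)^{q-1} h^{q-1} / ((1-x)(q-1)!)`. -/
theorem correlation_height_integral (q : ℕ) (hq : 3 ≤ q)
    (h x a a₁ : ℝ) (hh : 0 < h) (hx0 : 0 ≤ x) (hx1 : x < 1)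
    (hxa : x ≤ a) (ha1 : a ≤ 1) (ha₁ : 0 ≤ a₁)
    (hcompat : (1 - x) * a₁ ≤ 1 - a) :
    (∫ h₁ in (a₁ * h)..(((1 - a) / (1 - x)) * h),
      ∫ h₂ in (a * h - x * h₁)..(h - h₁), (h - h₁ - h₂) ^ (q - 3)) =
      ((q - 3)! : ℝ) * ((1 - a) - (1 - x) * a₁) ^ (q - 1) * h ^ (q - 1) /
        ((1 - x) * ((q - 1)! : ℝ)) := by
  obtain ⟨n, rfl⟩ := Nat.exists_eq_add_of_le' hq
  have hx : (1 - x) ≠ 0 := by linarith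
  have inner (h₁ : ℝ) : (∫ h₂ in (a * h - x * h₁)..(h - h₁), (h - h₁ - h₂) ^ n) =
      ((1 - a) * h - (1 - x) * h₁) ^ (n + 1) / (n + 1) := by
    rw [intervalIntegral.integral_comp_sub_left (fun t : ℝ => t ^ n), integral_pow, sub_self,
      zero_pow n.succ_ne_zero, sub_zero]
    ring
  have upper : (1 - a) * h - (1 - x) * ((1 - a) / (1 - x) * h) = 0 := by
    field_simp
    ring
  have lower : (1 - a) * h - (1 - x) * (a₁ * h) = ((1 - a) - (1 - x) * a₁) * h := by ring
  have hfac : ((n + 2)! : ℝ) = (n + 2) * ((n + 1) * (n ! : ℝ)) := by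
    rw [Nat.factorial_succ, Nat.factorial_succ]
    push_cast
    ring
  have hn : (n ! : ℝ) ≠ 0 := by positivity
  have hn1 : (n + 1 : ℝ) ≠ 0 := by positivity
  have hn2 : (n + 2 : ℝ) ≠ 0 := by positivity
  simp only [Nat.add_sub_cancel, show n + 3 - 1 = n + 2 from rfl, inner]
  rw [intervalIntegral.integral_div,
    intervalIntegral.integral_comp_sub_mul (fun t : ℝ => t ^ (n + 1)) hx, integral_pow, upper,
    lower, zero_pow (by lia), sub_zero, mul_pow, hfac, smul_eq_mul]
  push_cast
  rw [show (n + 1 + 1 : ℝ) = n + 2 by ring]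
  field_simp
end
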